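/- arXiv:1111.3973 — 7 statements merged into one kernel-verified Lean document; each statement's English description precedes it below -/
import Mathlib

section
/- Let I be an ideal of O₀. Then the quotient O₀/I is finite-dimensional as a ℂ-vector space (i.e., I is cofinite) if and only if there exists k ∈ ℕ such that M^(k+1) ⊆ I. -/
open Filter Topology

noncomputable section

namespace PaleyWiener

/-- The `ℂ`-algebra structure on germs of `ℂ`-valued functions, via constant germs. -/
instance germAlgebra {α : Type*} {l : Filter α} : Algebra ℂ (Filter.Germ l ℂ) :=
  Algebra.ofModule
    (fun c x y => by
      refine x.inductionOn fun f => y.inductionOn fun g => ?_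
      rw [← Filter.Germ.coe_smul, ← Filter.Germ.coe_mul, ← Filter.Germ.coe_mul,
        ← Filter.Germ.coe_smul, smul_mul_assoc])
    (fun c x y => by
      refine x.inductionOn fun f => y.inductionOn fun g => ?_
      rw [← Filter.Germ.coe_smul, ← Filter.Germ.coe_mul, ← Filter.Germ.coe_mul,
        ← Filter.Germ.coe_smul, mul_smul_comm])

variable (n : ℕ)

/-- The ring of germs at `0` of holomorphic functions on `ℂⁿ`, realized as the subalgebra of
`Filter.Germ (𝓝 0) ℂ` of germs admitting a representative analytic at `0`. -/
def O0 : Subalgebra ℂ (Filter.Germ (𝓝 (0 : Fin n → ℂ)) ℂ) where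
  carrier := {g | ∃ f : (Fin n → ℂ) → ℂ, AnalyticAt ℂ f 0 ∧ g = ↑f}
  mul_mem' := by
    rintro a b ⟨f, hf, rfl⟩ ⟨g, hg, rfl⟩
    exact ⟨f * g, hf.mul hg, rfl⟩
  add_mem' := by
    rintro a b ⟨f, hf, rfl⟩ ⟨g, hg, rfl⟩
    exact ⟨f + g, hf.add hg, rfl⟩
  algebraMap_mem' := fun c => ⟨fun _ => c, analyticAt_const, by
    rw [Algebra.algebraMap_eq_smul_one]
    have h : ((fun _ : Fin n → ℂ => c) : (Fin n → ℂ) → ℂ) = c • (1 : (Fin n → ℂ) → ℂ) := by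
      funext x; simp
    rw [h, Filter.Germ.coe_smul, Filter.Germ.coe_one]⟩

/-- Evaluation at `0` of a germ at `𝓝 0`, as a ring homomorphism; this is well defined
since every neighborhood of `0` contains `0`. -/
def germEval0 : Filter.Germ (𝓝 (0 : Fin n → ℂ)) ℂ →+* ℂ where
  toFun g := g.liftOn (fun f => f 0) fun _ _ h => h.self_of_nhds
  map_one' := rfl
  map_mul' a b := a.inductionOn₂ b fun _ _ => rfl
  map_zero' := rfl
  map_add' a b := a.inductionOn₂ b fun _ _ => rfl

/-- Evaluation at `0` on `O₀`. -/
def evalO0 : O0 n →+* ℂ := (germEval0 n).comp ((O0 n).val : O0 n →ₐ[ℂ] _).toRingHom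

/-- The maximal ideal `M` of `O₀`, consisting of the germs vanishing at `0`. -/
def Mideal : Ideal (O0 n) := RingHom.ker (evalO0 n)

end PaleyWiener

namespace PaleyWiener

theorem hadamard (n : ℕ) (f : (Fin n → ℂ) → ℂ) (hf : AnalyticAt ℂ f 0) (h0 : f 0 = 0) :
    ∃ g : Fin n → (Fin n → ℂ) → ℂ, (∀ i, AnalyticAt ℂ (g i) 0) ∧
      f =ᶠ[𝓝 0] fun z => ∑ i, g i z * z i := by
  obtain ⟨p, hp⟩ := hf
  obtain ⟨r, hr⟩ := hp
  have hrad : 0 < p.shift.radius := by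
    rw [FormalMultilinearSeries.radius_shift]
    exact hr.r_pos.trans_le hr.r_le
  have hG := p.shift.hasFPowerSeriesOnBall hrad
  set G := p.shift.sum with hGdef
  have hGa : AnalyticAt ℂ G 0 := hG.analyticAt
  refine ⟨fun i z => G z (Pi.single i 1), fun i => ?_, ?_⟩
  · exact ((ContinuousLinearMap.apply ℂ ℂ (Pi.single i (1:ℂ) : Fin n → ℂ)).analyticAt _).comp hGa
  · filter_upwards [Metric.eball_mem_nhds (0 : Fin n → ℂ) hr.r_pos,
      Metric.eball_mem_nhds (0 : Fin n → ℂ) hrad] with z hz hz'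
    have h1 := hr.hasSum hz
    have h2 := hG.hasSum hz'
    rw [zero_add] at h1 h2
    have h3 := (ContinuousLinearMap.apply ℂ ℂ z).hasSum h2
    have h4 := (hasSum_nat_add_iff' 1).2 h1
    have h5 : (p 0 fun _ => z) = 0 := by
      rw [hr.coeff_zero]; exact h0
    simp only [Finset.range_one, Finset.sum_singleton, h5, sub_zero] at h4
    have h6 : f z = G z z := by
      refine h4.unique ?_
      have h7 : ∀ k, (p (k+1) fun _ => z) =
          ContinuousLinearMap.apply ℂ ℂ z (p.shift k fun _ => z) := by
        intro k
        rw [ContinuousLinearMap.apply_apply]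
        change _ = (p (k+1)).curryRight (fun _ => z) z
        rw [ContinuousMultilinearMap.curryRight_apply]
        congr 1
        funext i
        refine Fin.lastCases ?_ (fun j => ?_) i
        · simp
        · simp
      simp only [h7]
      exact h3
    rw [h6]
    have h8 : z = ∑ i, z i • (Pi.single i (1:ℂ) : Fin n → ℂ) := by
      funext j
      simp [Finset.sum_apply, Pi.single_apply]
    generalize G z = L
    conv_lhs => rw [h8, map_sum]
    simp [mul_comm]

theorem evalO0_mk (n : ℕ) (f : (Fin n → ℂ) → ℂ) (h) :
    evalO0 n ⟨(f : Filter.Germ (𝓝 (0 : Fin n → ℂ)) ℂ), h⟩ = f 0 := rfl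

theorem evalO0_algebraMap (n : ℕ) (c : ℂ) : evalO0 n (algebraMap ℂ (O0 n) c) = c := by
  have : algebraMap ℂ (O0 n) c = c • 1 := Algebra.algebraMap_eq_smul_one c
  rw [this]
  change c * 1 = c
  exact mul_one c

theorem exists_pow_le {R A : Type*} [CommRing R] [CommRing A] [IsArtinianRing A] (φ : R →+* A)
    (hφ : Function.Surjective φ) (M : Ideal R) (hM : ∀ x ∈ M, ∀ y, IsUnit (x * y + 1)) :
    ∃ k : ℕ, M ^ (k + 1) ≤ RingHom.ker φ := by
  obtain ⟨k, hk⟩ := IsArtinianRing.isNilpotent_jacobson_bot (R := A)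
  have hle : M.map φ ≤ Ideal.jacobson ⊥ := by
    rw [Ideal.map_le_iff_le_comap]
    intro x hx
    rw [Ideal.mem_comap, Ideal.mem_jacobson_bot]
    intro y
    obtain ⟨y, rfl⟩ := hφ y
    rw [← map_mul, ← map_one φ, ← map_add]
    exact (hM x hx y).map φ
  refine ⟨k, (Ideal.pow_le_pow_right (Nat.le_succ k)).trans ?_⟩
  have h2 := Ideal.pow_right_mono hle k
  rw [hk, ← Ideal.map_pow, Ideal.map_le_iff_le_comap] at h2
  exact h2

theorem finite_of_decomp {R A : Type*} [CommRing R] [Algebra ℂ R] [AddCommGroup A] [Module ℂ A]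
    (φ : R →ₗ[ℂ] A) (hφ : Function.Surjective φ) (P : Submodule ℂ R) (hP : P.FG)
    (h : ∀ x, ∃ y ∈ P, φ (x - y) = 0) : FiniteDimensional ℂ A := by
  have h1 : P.map φ = ⊤ := by
    rw [eq_top_iff]
    intro x _
    obtain ⟨x, rfl⟩ := hφ x
    obtain ⟨y, hy, hxy⟩ := h x
    refine ⟨y, hy, ?_⟩
    rw [map_sub, sub_eq_zero] at hxy
    exact hxy.symm
  exact ⟨h1 ▸ hP.map φ⟩

theorem pow_le_of_finite {R : Type*} [CommRing R] [Algebra ℂ R] (I M : Ideal R)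
    (hM : ∀ x ∈ M, ∀ y, IsUnit (x * y + 1)) (hfin : FiniteDimensional ℂ (R ⧸ I)) :
    ∃ k : ℕ, M ^ (k + 1) ≤ I := by
  have hart : IsArtinianRing (R ⧸ I) := IsArtinianRing.of_finite ℂ _
  obtain ⟨k, hk⟩ := exists_pow_le (Ideal.Quotient.mk I) Ideal.Quotient.mk_surjective M hM
  exact ⟨k, fun x hx => Ideal.Quotient.eq_zero_iff_mem.1 (hk hx)⟩

theorem finite_of_pow_le {R : Type*} [CommRing R] [Algebra ℂ R] (I M : Ideal R)
    (P : Submodule ℂ R) (hP : P.FG) (hk : M ≤ I)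
    (h : ∀ x, ∃ y ∈ P, x - y ∈ M) : FiniteDimensional ℂ (R ⧸ I) := by
  refine finite_of_decomp (Ideal.Quotient.mkₐ ℂ I).toLinearMap Ideal.Quotient.mk_surjective P hP
    fun x => ?_
  obtain ⟨y, hy, hxy⟩ := h x
  exact ⟨y, hy, Ideal.Quotient.eq_zero_iff_mem.2 (hk hxy)⟩

theorem isUnit_of_eval (n : ℕ) (a : O0 n) (h : evalO0 n a ≠ 0) : IsUnit a := by
  obtain ⟨a, f, hf, rfl⟩ := a
  replace h : f 0 ≠ 0 := h
  refine IsUnit.of_mul_eq_one ⟨((f⁻¹ : (Fin n → ℂ) → ℂ) : Filter.Germ (𝓝 (0 : Fin n → ℂ)) ℂ), f⁻¹, hf.inv h, rfl⟩ ?_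
  apply Subtype.ext
  change ((f * f⁻¹ : (Fin n → ℂ) → ℂ) : Filter.Germ (𝓝 (0 : Fin n → ℂ)) ℂ) = ((1 : (Fin n → ℂ) → ℂ) : Filter.Germ _ _)
  rw [Filter.Germ.coe_eq]
  filter_upwards [hf.continuousAt.eventually_ne h] with z hz
  simp [hz]

/-- Coordinate germs. -/
def coordO0 (n : ℕ) (i : Fin n) : O0 n :=
  ⟨((fun z => z i : (Fin n → ℂ) → ℂ) : Filter.Germ (𝓝 (0 : Fin n → ℂ)) ℂ), _,
    (ContinuousLinearMap.proj (R := ℂ) (φ := fun _ : Fin n => ℂ) i).analyticAt 0, rfl⟩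

theorem coe_sum_germ {α ι : Type*} {l : Filter α} (s : Finset ι) (F : ι → α → ℂ) :
    ((∑ i ∈ s, F i : α → ℂ) : Filter.Germ l ℂ) = ∑ i ∈ s, (F i : Filter.Germ l ℂ) :=
  map_sum (Filter.Germ.coeRingHom l) F s

theorem Mideal_fg (n : ℕ) : (Mideal n).FG := by
  classical
  refine ⟨Finset.univ.image (coordO0 n), le_antisymm ?_ ?_⟩
  · rw [Ideal.span_le]
    intro x hx
    simp only [Finset.coe_image, Finset.coe_univ, Set.image_univ, Set.mem_range] at hx
    obtain ⟨i, rfl⟩ := hx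
    rfl
  · rintro ⟨a, f, hf, rfl⟩ ha
    have h0 : f 0 = 0 := ha
    obtain ⟨g, hg, hfg⟩ := hadamard n f hf h0
    have key : (⟨(f : Filter.Germ (𝓝 (0 : Fin n → ℂ)) ℂ), f, hf, rfl⟩ : O0 n) =
        ∑ i, (⟨(g i : Filter.Germ (𝓝 (0 : Fin n → ℂ)) ℂ), g i, hg i, rfl⟩ : O0 n) * coordO0 n i := by
      apply Subtype.ext
      rw [AddSubmonoidClass.coe_finsetSum]
      change (f : Filter.Germ (𝓝 (0 : Fin n → ℂ)) ℂ) = ∑ i, ((g i * fun z => z i : (Fin n → ℂ) → ℂ) : Filter.Germ (𝓝 (0 : Fin n → ℂ)) ℂ)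
      rw [← coe_sum_germ, Filter.Germ.coe_eq]
      refine hfg.trans (Filter.Eventually.of_forall fun z => ?_)
      simp
    rw [key]
    refine Ideal.sum_mem _ fun i _ => Ideal.mul_mem_left _ _ (Ideal.subset_span ?_)
    simp

theorem decomp (n k : ℕ) : ∃ P : Submodule ℂ (O0 n), P.FG ∧
    ∀ x : O0 n, ∃ y ∈ P, x - y ∈ (Mideal n) ^ k := by
  classical
  induction k with
  | zero => exact ⟨⊥, Submodule.fg_bot, fun x => ⟨0, by simp, by simp⟩⟩
  | succ k ih =>
    obtain ⟨P, hP, h⟩ := ih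
    obtain ⟨S, hS⟩ := (Mideal_fg n).pow (n := k)
    refine ⟨P ⊔ Submodule.span ℂ (S : Set (O0 n)), hP.sup ⟨S, rfl⟩, fun x => ?_⟩
    obtain ⟨y, hy, hxy⟩ := h x
    suffices H : ∀ w ∈ (Mideal n) ^ k, ∃ u ∈ Submodule.span ℂ (S : Set (O0 n)), w - u ∈ (Mideal n) ^ (k+1) by
      obtain ⟨u, hu, hw⟩ := H _ hxy
      refine ⟨y + u, Submodule.add_mem_sup hy hu, ?_⟩
      rwa [← sub_sub]
    intro w hw
    rw [← hS] at hw
    induction hw using Submodule.span_induction with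
    | mem s hs => exact ⟨s, Submodule.subset_span hs, by simp⟩
    | zero => exact ⟨0, by simp, by simp⟩
    | add a b _ _ ha hb =>
      obtain ⟨u, hu, h1⟩ := ha
      obtain ⟨v, hv, h2⟩ := hb
      exact ⟨u + v, add_mem hu hv, by rw [add_sub_add_comm]; exact add_mem h1 h2⟩
    | smul c a hamem ha =>
      obtain ⟨u, hu, h1⟩ := ha
      have ha' : a ∈ (Mideal n) ^ k := hS ▸ hamem
      refine ⟨evalO0 n c • u, Submodule.smul_mem _ _ hu, ?_⟩
      have hc : c - algebraMap ℂ (O0 n) (evalO0 n c) ∈ Mideal n := by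
        change evalO0 n _ = 0
        rw [map_sub, sub_eq_zero]
        rw [evalO0_algebraMap]
      have e : c • a - evalO0 n c • u = (c - algebraMap ℂ (O0 n) (evalO0 n c)) * a +
          algebraMap ℂ (O0 n) (evalO0 n c) * (a - u) := by
        rw [smul_eq_mul, Algebra.smul_def]; ring
      rw [e]
      refine add_mem ?_ (Ideal.mul_mem_left _ _ h1)
      rw [pow_succ']
      exact Ideal.mul_mem_mul hc ha'

set_option synthInstance.maxHeartbeats 1000000 in
/-- An ideal `I` of `O₀` is cofinite (i.e. `O₀/I` is finite-dimensional as a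
`ℂ`-vector space) if and only if there exists `k ∈ ℕ` with `M^(k+1) ⊆ I`. -/
theorem cofinite_iff_pow_maximalIdeal_le (n : ℕ) (hn : 1 ≤ n) (I : Ideal (O0 n)) :
    FiniteDimensional ℂ (O0 n ⧸ I) ↔ ∃ k : ℕ, (Mideal n) ^ (k + 1) ≤ I := by
  constructor
  · intro hfin
    refine pow_le_of_finite I (Mideal n) (fun x hx y => isUnit_of_eval n _ ?_) hfin
    have hx' : evalO0 n x = 0 := hx
    rw [map_add, map_mul, hx', map_one, zero_mul, zero_add]
    exact one_ne_zero
  · rintro ⟨k, hk⟩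
    obtain ⟨P, hP, h⟩ := decomp n (k + 1)
    exact finite_of_pow_le I _ P hP hk h

end PaleyWiener
end
end

section
/- Let k ∈ ℕ and let c ∈ D. Then ⟨g, c⟩ = 0 for every germ g ∈ M^(k+1) if and only if c is supported on multi-indices of total degree at most k. (In the paper's notation: S_k(𝔳) = S_{M^(k+1)}(𝔳).) -/
open Filter Topology

noncomputable section

namespace PaleyWiener

/-- The partial derivative of `f : ℂⁿ → ℂ` in the `i`-th coordinate direction. -/
def pdi (n : ℕ) (i : Fin n) (f : (Fin n → ℂ) → ℂ) : (Fin n → ℂ) → ℂ :=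
  fun x => fderiv ℂ f x (Pi.single i 1)

/-- The iterated partial derivative `∂^α f` of `f : ℂⁿ → ℂ` along the coordinate directions,
for a multi-index `α`. -/
def pdMulti (n : ℕ) (α : Fin n →₀ ℕ) (f : (Fin n → ℂ) → ℂ) : (Fin n → ℂ) → ℂ :=
  (List.finRange n).foldr (fun i g => (pdi n i)^[α i] g) f

/-- Vanishing to order `k` at `0`. -/
def J (n : ℕ) : ℕ → ((Fin n → ℂ) → ℂ) → Prop
  | 0, _ => True
  | k + 1, f => f 0 = 0 ∧ ∀ i, J n k (pdi n i f)

theorem pdi_analytic {n : ℕ} (i : Fin n) {f : (Fin n → ℂ) → ℂ} (hf : AnalyticAt ℂ f 0) :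
    AnalyticAt ℂ (pdi n i f) 0 := by
  have h := hf.fderiv
  exact ((ContinuousLinearMap.apply ℂ ℂ (Pi.single i (1 : ℂ) : Fin n → ℂ)).analyticAt _).comp h

theorem pdi_congr {n : ℕ} (i : Fin n) {f g : (Fin n → ℂ) → ℂ} (h : f =ᶠ[𝓝 0] g) :
    pdi n i f =ᶠ[𝓝 0] pdi n i g := by
  filter_upwards [h.fderiv (𝕜 := ℂ)] with x hx
  simp only [pdi, hx]

theorem pdi_add {n : ℕ} (i : Fin n) {f g : (Fin n → ℂ) → ℂ} (hf : AnalyticAt ℂ f 0)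
    (hg : AnalyticAt ℂ g 0) : pdi n i f + pdi n i g =ᶠ[𝓝 0] pdi n i (f + g) := by
  filter_upwards [hf.eventually_analyticAt, hg.eventually_analyticAt] with x h1 h2
  simp only [pdi, Pi.add_apply]
  rw [fderiv_add h1.differentiableAt h2.differentiableAt]
  rfl

theorem pdi_mul {n : ℕ} (i : Fin n) {f g : (Fin n → ℂ) → ℂ} (hf : AnalyticAt ℂ f 0)
    (hg : AnalyticAt ℂ g 0) :
    pdi n i f * g + f * pdi n i g =ᶠ[𝓝 0] pdi n i (f * g) := by
  filter_upwards [hf.eventually_analyticAt, hg.eventually_analyticAt] with x h1 h2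
  simp only [pdi, Pi.add_apply, Pi.mul_apply]
  rw [fderiv_mul h1.differentiableAt h2.differentiableAt]
  simp
  ring

theorem J_congr {n : ℕ} (k : ℕ) : ∀ {f g : (Fin n → ℂ) → ℂ}, f =ᶠ[𝓝 0] g → J n k f → J n k g := by
  induction k with
  | zero => intro f g _ _; trivial
  | succ k ih =>
    rintro f g h ⟨h0, h1⟩
    exact ⟨by rw [← h.self_of_nhds]; exact h0, fun i => ih (pdi_congr i h) (h1 i)⟩

theorem J_add {n : ℕ} (k : ℕ) : ∀ {f g : (Fin n → ℂ) → ℂ}, AnalyticAt ℂ f 0 → AnalyticAt ℂ g 0 →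
    J n k f → J n k g → J n k (f + g) := by
  induction k with
  | zero => intros; trivial
  | succ k ih =>
    rintro f g hf hg ⟨h0, h1⟩ ⟨h2, h3⟩
    exact ⟨by simp [h0, h2], fun i => J_congr k (pdi_add i hf hg)
      (ih (pdi_analytic i hf) (pdi_analytic i hg) (h1 i) (h3 i))⟩

theorem J_mono {n : ℕ} (k : ℕ) : ∀ {f : (Fin n → ℂ) → ℂ}, J n (k + 1) f → J n k f := by
  induction k with
  | zero => intros; trivial
  | succ k ih =>
    rintro f ⟨h0, h1⟩
    exact ⟨h0, fun i => ih (h1 i)⟩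

theorem J_mono_le {n : ℕ} {k m : ℕ} (h : k ≤ m) {f : (Fin n → ℂ) → ℂ} (hf : J n m f) :
    J n k f := by
  induction h with
  | refl => exact hf
  | step _ ih => exact ih (J_mono _ hf)

theorem J_mul {n : ℕ} (k : ℕ) : ∀ {f g : (Fin n → ℂ) → ℂ}, AnalyticAt ℂ f 0 → AnalyticAt ℂ g 0 →
    J n k f → J n k (f * g) := by
  induction k with
  | zero => intros; trivial
  | succ k ih =>
    rintro f g hf hg h
    refine ⟨by simp [h.1], fun i => J_congr k (pdi_mul i hf hg) ?_⟩
    exact J_add k ((pdi_analytic i hf).mul hg) (hf.mul (pdi_analytic i hg))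
      (ih (pdi_analytic i hf) hg (h.2 i)) (ih hf (pdi_analytic i hg) (J_mono k h))

theorem J_mul_one {n : ℕ} (k : ℕ) : ∀ {f g : (Fin n → ℂ) → ℂ}, AnalyticAt ℂ f 0 →
    AnalyticAt ℂ g 0 → J n k f → g 0 = 0 → J n (k + 1) (f * g) := by
  induction k with
  | zero => intro f g _ _ _ h; exact ⟨by simp [h], fun _ => trivial⟩
  | succ k ih =>
    rintro f g hf hg h h0
    refine ⟨by simp [h0], fun i => J_congr _ (pdi_mul i hf hg) ?_⟩
    exact J_add _ ((pdi_analytic i hf).mul hg) (hf.mul (pdi_analytic i hg))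
      (ih (pdi_analytic i hf) hg (h.2 i) h0) (J_mul _ hf (pdi_analytic i hg) h)

theorem J_zero {n : ℕ} (k : ℕ) : J n k 0 := by
  induction k with
  | zero => trivial
  | succ k ih =>
    refine ⟨rfl, fun i => ?_⟩
    have : pdi n i 0 = 0 := by
      funext x
      simp [pdi]
    rw [this]; exact ih

/-- The ideal of germs vanishing to order `k`. -/
def JI (n k : ℕ) : Ideal (O0 n) where
  carrier := {g | ∃ f : (Fin n → ℂ) → ℂ, AnalyticAt ℂ f 0 ∧ g.1 = ↑f ∧ J n k f}
  zero_mem' := ⟨0, analyticAt_const, rfl, J_zero k⟩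
  add_mem' := by
    rintro ⟨a, ha⟩ ⟨b, hb⟩ ⟨f, hf, h1, h2⟩ ⟨g, hg, h3, h4⟩
    simp only at h1 h3
    subst h1 h3
    exact ⟨f + g, hf.add hg, rfl, J_add k hf hg h2 h4⟩
  smul_mem' := by
    rintro ⟨a, f, hf, rfl⟩ ⟨b, hb⟩ ⟨g, hg, h3, h4⟩
    simp only at h3
    subst h3
    refine ⟨g * f, hg.mul hf, ?_, J_mul k hg hf h4⟩
    rw [mul_comm]
    rfl

theorem pow_le_JI (n k : ℕ) : Mideal n ^ k ≤ JI n k := by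
  induction k with
  | zero =>
    rintro ⟨a, f, hf, rfl⟩ _
    exact ⟨f, hf, rfl, trivial⟩
  | succ k ih =>
    rw [pow_succ]
    refine Ideal.mul_le.2 ?_
    rintro r hr ⟨b, g, hg, rfl⟩ hs
    obtain ⟨f, hf, h1, h2⟩ := ih hr
    obtain ⟨r, hr'⟩ := r
    simp only at h1
    subst h1
    have h0 : g 0 = 0 := hs
    exact ⟨f * g, hf.mul hg, rfl, J_mul_one k hf hg h2 h0⟩

theorem J_iter {n : ℕ} (i : Fin n) (m a : ℕ) : ∀ {f : (Fin n → ℂ) → ℂ}, J n (m + a) f →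
    J n m ((pdi n i)^[a] f) := by
  induction a with
  | zero => intro f h; exact h
  | succ a ih => intro f h; exact ih (h.2 i)

theorem J_foldr {n : ℕ} (α : Fin n →₀ ℕ) (f : (Fin n → ℂ) → ℂ) (l : List (Fin n)) : ∀ (m : ℕ),
    J n (m + (l.map α).sum) f → J n m (l.foldr (fun i g => (pdi n i)^[α i] g) f) := by
  induction l with
  | nil => intro m h; exact h
  | cons i l ih =>
    intro m h
    refine J_iter i m _ (ih _ ?_)
    simpa [add_assoc] using h

theorem sum_eq' {n : ℕ} (α : Fin n →₀ ℕ) :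
    (α.sum fun _ d => d) = ((List.finRange n).map α).sum := by
  rw [Finsupp.sum_fintype _ _ (fun _ => rfl), Fin.sum_univ_def]

theorem pdi_poly {n : ℕ} (i : Fin n) (p : MvPolynomial (Fin n) ℂ) :
    pdi n i (fun x => MvPolynomial.eval x p) =
      fun x => MvPolynomial.eval x (MvPolynomial.pderiv i p) := by
  have key : ∀ x, HasFDerivAt (𝕜 := ℂ) (fun x => MvPolynomial.eval x p)
      (∑ j, MvPolynomial.eval x (MvPolynomial.pderiv j p) •
        (ContinuousLinearMap.proj j : (Fin n → ℂ) →L[ℂ] ℂ)) x := by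
    intro x
    induction p using MvPolynomial.induction_on with
    | C a =>
      simp only [MvPolynomial.eval_C]
      refine (hasFDerivAt_const (𝕜 := ℂ) a x).congr_fderiv ?_
      ext v
      simp
    | add p q hp hq =>
      simp only [map_add]
      refine (hp.add hq).congr_fderiv ?_
      ext v
      simp [add_mul, Finset.sum_add_distrib]
    | mul_X p j hp =>
      simp only [map_mul, MvPolynomial.eval_X]
      have h := hp.mul (ContinuousLinearMap.proj j : (Fin n → ℂ) →L[ℂ] ℂ).hasFDerivAt
      refine h.congr_fderiv ?_
      ext v
      simp only [MvPolynomial.pderiv_X, Derivation.leibniz, smul_eq_mul, map_add, map_mul,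
        MvPolynomial.eval_X, ContinuousLinearMap.add_apply, ContinuousLinearMap.smul_apply,
        ContinuousLinearMap.sum_apply, ContinuousLinearMap.proj_apply, add_mul,
        Finset.sum_add_distrib, Finset.mul_sum]
      congr 1
      · simp [Pi.single_apply, apply_ite]
      · exact Finset.sum_congr rfl fun i _ => by ring
  funext x
  simp only [pdi, (key x).fderiv]
  simp [Pi.single_apply]

theorem pdi_iter_mono {n : ℕ} (i : Fin n) (b : ℕ) (s : Fin n →₀ ℕ) (a : ℂ) :
    (pdi n i)^[b] (fun x => MvPolynomial.eval x (MvPolynomial.monomial s a)) =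
      fun x => MvPolynomial.eval x (MvPolynomial.monomial (s - Finsupp.single i b)
        (a * ((s i).descFactorial b : ℂ))) := by
  induction b with
  | zero => simp
  | succ b ih =>
    rw [Function.iterate_succ_apply', ih, pdi_poly]
    funext x
    rw [MvPolynomial.pderiv_monomial]
    congr 2
    · rw [tsub_tsub, ← Finsupp.single_add]
    · rw [Nat.descFactorial_succ]
      simp
      ring

theorem foldr_mono {n : ℕ} (β s : Fin n →₀ ℕ) (l : List (Fin n)) (hl : l.Nodup) :
    ∃ t : Fin n →₀ ℕ, (∀ i, t i = if i ∈ l then s i - β i else s i) ∧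
    l.foldr (fun i g => (pdi n i)^[β i] g)
      (fun x => MvPolynomial.eval x (MvPolynomial.monomial s (1 : ℂ))) =
      fun x => MvPolynomial.eval x (MvPolynomial.monomial t
        ((l.map fun i => ((s i).descFactorial (β i) : ℂ)).prod)) := by
  induction l with
  | nil => exact ⟨s, by simp, by simp⟩
  | cons j l ih =>
    rw [List.nodup_cons] at hl
    obtain ⟨t, h1, h2⟩ := ih hl.2
    refine ⟨t - Finsupp.single j (β j), ?_, ?_⟩
    · intro i
      by_cases hij : i = j
      · subst hij
        simp [h1, hl.1]
      · have : j ≠ i := fun h => hij h.symm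
        simp [h1, hij, Finsupp.single_apply, this]
    · rw [List.foldr_cons, h2, pdi_iter_mono]
      have : t j = s j := by simp [h1, hl.1]
      simp only [this, List.map_cons, List.prod_cons]
      simp only [mul_comm]

theorem pdMulti_mono {n : ℕ} (β s : Fin n →₀ ℕ) :
    pdMulti n β (fun x => MvPolynomial.eval x (MvPolynomial.monomial s (1 : ℂ))) 0 =
      if β = s then ∏ i, ((s i).factorial : ℂ) else 0 := by
  obtain ⟨t, h1, h2⟩ := foldr_mono β s (List.finRange n) (List.nodup_finRange n)
  rw [pdMulti, h2]
  simp only [MvPolynomial.eval_monomial, ← Fin.prod_univ_def]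
  split_ifs with h
  · subst h
    have : t = 0 := by ext i; simp [h1]
    simp [this, Nat.descFactorial_self]
  · by_cases hle : ∀ i, β i ≤ s i
    · obtain ⟨i, hi⟩ : ∃ i, β i ≠ s i := by
        by_contra! hh
        exact h (Finsupp.ext hh)
      have hti : t i ≠ 0 := by
        have := hle i
        simp [h1]; omega
      refine mul_eq_zero_of_right _ ?_
      refine Finset.prod_eq_zero (i := i) (by simpa using hti) ?_
      simp [hti]
    · push Not at hle
      obtain ⟨i, hi⟩ := hle
      refine mul_eq_zero_of_left ?_ _
      refine Finset.prod_eq_zero (Finset.mem_univ i) ?_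
      simpa using hi

/-- The germ of `f` lies in `M ^ m`. -/
def PM (n m : ℕ) (f : (Fin n → ℂ) → ℂ) : Prop :=
  ∃ hf : AnalyticAt ℂ f 0, (⟨↑f, f, hf, rfl⟩ : O0 n) ∈ (Mideal n) ^ m

theorem PM_one (n : ℕ) : PM n 0 1 := ⟨analyticAt_const, by simp⟩

theorem PM_mul {n a b : ℕ} {f g : (Fin n → ℂ) → ℂ} (hf : PM n a f) (hg : PM n b g) :
    PM n (a + b) (f * g) := by
  obtain ⟨h1, h2⟩ := hf
  obtain ⟨h3, h4⟩ := hg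
  refine ⟨h1.mul h3, ?_⟩
  rw [pow_add]
  exact Ideal.mul_mem_mul h2 h4

theorem PM_pow {n : ℕ} {f : (Fin n → ℂ) → ℂ} (hf : PM n 1 f) (a : ℕ) : PM n a (f ^ a) := by
  induction a with
  | zero => simpa using PM_one n
  | succ a ih => rw [pow_succ]; exact PM_mul ih hf

theorem PM_coord {n : ℕ} (i : Fin n) : PM n 1 (fun x => x i) := by
  refine ⟨(ContinuousLinearMap.proj i : (Fin n → ℂ) →L[ℂ] ℂ).analyticAt _, ?_⟩
  rw [pow_one]
  rfl

theorem PM_prod {n : ℕ} (s : Fin n →₀ ℕ) (u : Finset (Fin n)) :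
    PM n (∑ i ∈ u, s i) (∏ i ∈ u, (fun x : Fin n → ℂ => x i) ^ s i) := by
  classical
  induction u using Finset.induction_on with
  | empty => simpa using PM_one n
  | insert a u ha ih =>
    rw [Finset.sum_insert ha, Finset.prod_insert ha]
    exact PM_mul (PM_pow (PM_coord a) _) ih

theorem PM_mono {n : ℕ} (s : Fin n →₀ ℕ) :
    PM n (s.sum fun _ d => d)
      (fun x => MvPolynomial.eval x (MvPolynomial.monomial s (1 : ℂ))) := by
  have h := PM_prod s s.support
  convert h using 1
  · rfl
  funext x
  simp [MvPolynomial.eval_monomial, Finsupp.prod]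

set_option synthInstance.maxHeartbeats 1000000 in
/-- For `k ∈ ℕ` and `c ∈ D` (a finitely supported family of complex
coefficients indexed by multi-indices), the pairing `⟨g, c⟩ = Σ_α c_α (∂^α f)(0)` (with `f`
an analytic representative of `g`) vanishes for every germ `g ∈ M^(k+1)` if and only if `c`
is supported on multi-indices of total degree at most `k`.  (In the paper's notation:
`S_k(𝔳) = S_{M^(k+1)}(𝔳)`.) -/
theorem pairing_vanishes_on_pow_maximalIdeal_iff (n : ℕ) (hn : 1 ≤ n) (k : ℕ)
    (c : (Fin n →₀ ℕ) →₀ ℂ) :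
    (∀ (f : (Fin n → ℂ) → ℂ) (hf : AnalyticAt ℂ f 0),
        (⟨↑f, f, hf, rfl⟩ : O0 n) ∈ (Mideal n) ^ (k + 1) →
        (c.sum fun α cα => cα * pdMulti n α f 0) = 0) ↔
      ∀ α ∈ c.support, (α.sum fun _ d => d) ≤ k := by
  constructor
  · intro H α hα
    by_contra! hlt
    obtain ⟨hf, hm⟩ := PM_mono α
    have h := H _ hf (Ideal.pow_le_pow_right hlt hm)
    simp only [pdMulti_mono] at h
    rw [Finsupp.sum, Finset.sum_eq_single α] at h
    · simp only [if_true, mul_eq_zero] at h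
      rcases h with h | h
      · exact (Finsupp.mem_support_iff.1 hα) h
      · rw [Finset.prod_eq_zero_iff] at h
        obtain ⟨i, _, hi⟩ := h
        exact Nat.factorial_ne_zero _ (by exact_mod_cast hi)
    · intro b _ hb
      simp [hb]
    · intro h'
      exact absurd hα h'
  · intro H f hf hm
    obtain ⟨g, hg, h1, h2⟩ := pow_le_JI n (k + 1) hm
    have hfg : f =ᶠ[𝓝 0] g := Filter.Germ.coe_eq.1 h1
    have hJ : J n (k + 1) f := J_congr _ hfg.symm h2
    refine Finset.sum_eq_zero fun α hα => ?_
    have hk := H α hα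
    rw [sum_eq'] at hk
    have := J_foldr α f (List.finRange n) 1 (J_mono_le (by omega) hJ)
    exact mul_eq_zero_of_right _ this.1

end PaleyWiener
end
end

section
/- Let E be a module over O₀ which is finite-dimensional as a ℂ-vector space (the ℂ-scalar action, via constant germs, being compatible with the O₀-action). Then there exist k, N ∈ ℕ and a surjective O₀-linear map from the N-fold direct sum (O₀/M^(k+1))^N onto E, where O₀/M^(k+1) carries its natural O₀-module structure. -/
open Filter Topology

noncomputable section

namespace PaleyWiener

/-- General algebraic form: `I` inside the Jacobson radical, `E` finite-dimensional. -/
theorem exists_surj_of_le_jacobson {K R : Type*} [Field K] [CommRing R] [Algebra K R]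
    (I : Ideal R) (hI : I ≤ Ideal.jacobson ⊥) (E : Type*) [AddCommGroup E]
    [Module K E] [Module R E] [IsScalarTower K R E] [FiniteDimensional K E] :
    ∃ (k N : ℕ) (φ : (Fin N → (R ⧸ I ^ (k + 1))) →ₗ[R] E), Function.Surjective φ := by
  haveI : IsArtinian R E := isArtinian_of_tower K inferInstance
  haveI : IsNoetherian R E := isNoetherian_of_tower K inferInstance
  obtain ⟨k, hk⟩ := IsArtinian.monotone_stabilizes (R := R) (M := E)
    ⟨fun j => OrderDual.toDual (I ^ j • (⊤ : Submodule R E)),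
      fun a b h => Submodule.smul_mono_left (Ideal.pow_le_pow_right h)⟩
  have hk1 : I ^ k • (⊤ : Submodule R E) = I ^ (k + 1) • (⊤ : Submodule R E) :=
    hk (k + 1) (Nat.le_succ k)
  have h0 : I ^ k • (⊤ : Submodule R E) = ⊥ := by
    refine Submodule.eq_bot_of_le_smul_of_le_jacobson_bot I _ (IsNoetherian.noetherian _) ?_ hI
    rw [← Submodule.mul_smul, ← pow_succ']
    exact hk1.le
  have h1 : ∀ r ∈ I ^ (k + 1), ∀ x : E, r • x = 0 := by
    intro r hr x
    have : r • x ∈ I ^ (k + 1) • (⊤ : Submodule R E) :=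
      Submodule.smul_mem_smul hr Submodule.mem_top
    rw [← hk1, h0] at this
    simpa using this
  obtain ⟨N, v, hv⟩ := Module.Finite.exists_fin (R := R) (M := E)
  let ψ : Fin N → ((R ⧸ I ^ (k + 1)) →ₗ[R] E) := fun i =>
    Submodule.liftQ (I ^ (k + 1)) (LinearMap.toSpanSingleton R E (v i))
      (fun r hr => by simpa using h1 r hr (v i))
  refine ⟨k, N, LinearMap.lsum R (fun _ => R ⧸ I ^ (k + 1)) R ψ, ?_⟩
  rw [← LinearMap.range_eq_top, eq_top_iff, ← hv, Submodule.span_le]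
  rintro _ ⟨i, rfl⟩
  refine ⟨Pi.single i (Submodule.Quotient.mk 1), ?_⟩
  rw [LinearMap.lsum_piSingle]
  change Submodule.liftQ _ _ _ (Submodule.Quotient.mk 1) = _
  rw [Submodule.liftQ_apply]
  simp

theorem isUnit_of_evalO0_ne_zero (n : ℕ) (a : O0 n) (ha : evalO0 n a ≠ 0) : IsUnit a := by
  obtain ⟨_, f, hf, rfl⟩ := a
  have hf0 : f 0 ≠ 0 := ha
  refine IsUnit.of_mul_eq_one ⟨((f⁻¹ : (Fin n → ℂ) → ℂ) : Filter.Germ (𝓝 (0 : Fin n → ℂ)) ℂ),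
    f⁻¹, hf.inv hf0, rfl⟩ ?_
  apply Subtype.ext
  change ((f * f⁻¹ : (Fin n → ℂ) → ℂ) : Filter.Germ (𝓝 (0 : Fin n → ℂ)) ℂ) = ((1 : (Fin n → ℂ) → ℂ) : Filter.Germ (𝓝 (0 : Fin n → ℂ)) ℂ)
  refine Filter.Germ.coe_eq.2 ?_
  filter_upwards [hf.continuousAt.eventually_ne hf0] with x hx
  simp [hx]

theorem Mideal_le_jacobson (n : ℕ) : Mideal n ≤ Ideal.jacobson ⊥ := by
  intro a ha
  rw [Ideal.mem_jacobson_bot]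
  intro b
  apply isUnit_of_evalO0_ne_zero
  have : evalO0 n a = 0 := ha
  simp [this]


set_option synthInstance.maxHeartbeats 1000000 in
/-- Every `O₀`-module `E` which is finite-dimensional as a `ℂ`-vector space
(with compatible `ℂ`-action) is a quotient of `(O₀/M^(k+1))^N` for some `k, N ∈ ℕ`: there is
a surjective `O₀`-linear map `(O₀/M^(k+1))^N → E`. -/
theorem finite_module_quotient_of_power (n : ℕ) (hn : 1 ≤ n) (E : Type*) [AddCommGroup E]
    [Module ℂ E] [Module (O0 n) E] [IsScalarTower ℂ (O0 n) E] [FiniteDimensional ℂ E] :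
    ∃ (k N : ℕ) (φ : (Fin N → (O0 n ⧸ (Mideal n) ^ (k + 1))) →ₗ[O0 n] E),
      Function.Surjective φ := by
  exact exists_surj_of_le_jacobson (K := ℂ) (Mideal n) (Mideal_le_jacobson n) E

end PaleyWiener
end
end

section
/- End(V)₀ = End(V)_au as subsets of End_k(V); that is, the k-span of the rank-one operators w ↦ ξ(w)·v with v ∈ V and ξ ∈ V^∨ coincides with the set of φ ∈ End_k(V) for which there exists j ∈ J with π(α_j) ∘ φ ∘ π(α_j) = φ. -/
noncomputable section

namespace PaleyWiener

/-- Let `A` be a (not necessarily unital) associative `k`-algebra with an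
approximate identity `(α_j)_{j ∈ J}` indexed by a directed preordered set `J`, and let
`π : A → End_k(V)` make `V` an approximately unital admissible `A`-module.  Then
`End(V)₀ = End(V)_au`: the `k`-span of the rank-one operators `w ↦ ξ(w)·v` with `v ∈ V`,
`ξ ∈ V^∨` coincides with the set of `φ ∈ End_k(V)` such that
`π(α_j) ∘ φ ∘ π(α_j) = φ` for some `j ∈ J`. -/
theorem finiteRank_endomorphisms_eq_approximatelyUnital
    {k : Type*} [Field k] {A : Type*} [NonUnitalRing A] [Module k A]
    [SMulCommClass k A A] [IsScalarTower k A A]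
    {V : Type*} [AddCommGroup V] [Module k V]
    (π : A →ₙₐ[k] Module.End k V)
    {J : Type*} [Preorder J] (hdir : ∀ j₁ j₂ : J, ∃ j, j₁ ≤ j ∧ j₂ ≤ j)
    (α : J → A)
    (happrox : ∀ j₁ j₂, j₁ ≤ j₂ → α j₁ * α j₂ = α j₁ ∧ α j₂ * α j₁ = α j₁)
    (habsorb : ∀ a : A, ∃ j, α j * a = a ∧ a * α j = a)
    (hau : ∀ v : V, ∃ j, π (α j) v = v)
    (hadm : ∀ j, FiniteDimensional k (LinearMap.range (π (α j)))) :
    (Submodule.span k {φ : Module.End k V |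
        ∃ (v : V) (ξ : Module.Dual k V), (∃ j, ξ ∘ₗ π (α j) = ξ) ∧
          φ = LinearMap.smulRight ξ v} : Set (Module.End k V)) =
      {φ : Module.End k V | ∃ j, (π (α j)) ∘ₗ φ ∘ₗ (π (α j)) = φ} := by
  have hm : ∀ i j, i ≤ j → π (α i) ∘ₗ π (α j) = π (α i) ∧ π (α j) ∘ₗ π (α i) = π (α i) := by
    intro i j hij
    obtain ⟨h1, h2⟩ := happrox i j hij
    refine ⟨?_, ?_⟩
    · rw [← Module.End.mul_eq_comp, ← map_mul, h1]
    · rw [← Module.End.mul_eq_comp, ← map_mul, h2]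
  have hmv : ∀ i j, i ≤ j → ∀ v, π (α i) (π (α j) v) = π (α i) v ∧
      π (α j) (π (α i) v) = π (α i) v := fun i j hij v =>
    ⟨LinearMap.congr_fun (hm i j hij).1 v, LinearMap.congr_fun (hm i j hij).2 v⟩
  have lift : ∀ i j, i ≤ j → ∀ φ : Module.End k V, π (α i) ∘ₗ φ ∘ₗ π (α i) = φ →
      π (α j) ∘ₗ φ ∘ₗ π (α j) = φ := by
    intro i j hij φ h
    have h' : ∀ v, π (α i) (φ (π (α i) v)) = φ v := fun v => LinearMap.congr_fun h v
    ext v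
    simp only [LinearMap.comp_apply]
    rw [← h' (π (α j) v), (hmv i j hij _).2, (hmv i j hij _).1, h']
  apply Set.Subset.antisymm
  · intro φ hφ
    induction hφ using Submodule.span_induction with
    | mem φ h =>
      obtain ⟨v, ξ, ⟨j1, h1⟩, rfl⟩ := h
      obtain ⟨j2, h2⟩ := hau v
      obtain ⟨j, hj1, hj2⟩ := hdir j1 j2
      refine ⟨j, ?_⟩
      have hv : π (α j) v = v := by rw [← h2, (hmv j2 j hj2 v).2]
      have h1' : ∀ w, ξ (π (α j1) w) = ξ w := fun w => LinearMap.congr_fun h1 w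
      ext w
      have hw : ξ (π (α j) w) = ξ w := by rw [← h1' (π (α j) w), (hmv j1 j hj1 w).1, h1']
      simp [hv, hw]
    | zero =>
      obtain ⟨j, _⟩ := habsorb 0
      exact ⟨j, by simp⟩
    | add φ ψ _ _ h1 h2 =>
      obtain ⟨j1, h1⟩ := h1
      obtain ⟨j2, h2⟩ := h2
      obtain ⟨j, hj1, hj2⟩ := hdir j1 j2
      refine ⟨j, ?_⟩
      rw [LinearMap.add_comp, LinearMap.comp_add, lift j1 j hj1 φ h1, lift j2 j hj2 ψ h2]
    | smul c φ _ h =>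
      obtain ⟨j, h⟩ := h
      refine ⟨j, ?_⟩
      rw [LinearMap.smul_comp, LinearMap.comp_smul, h]
  · rintro φ ⟨j, h⟩
    have h' : ∀ v, π (α j) (φ (π (α j) v)) = φ v := fun v => LinearMap.congr_fun h v
    have hr : ∀ v, φ (π (α j) v) = φ v := fun v => by
      rw [← h' (π (α j) v), (hmv j j le_rfl v).1, h']
    have := hadm j
    let b := Module.finBasis k (LinearMap.range (π (α j)))
    have key : φ = ∑ i, LinearMap.smulRight (b.coord i ∘ₗ (π (α j)).rangeRestrict)
        (φ (b i : V)) := by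
      ext w
      have hs := congrArg (fun x : LinearMap.range (π (α j)) => φ (x : V))
        (b.sum_repr ((π (α j)).rangeRestrict w))
      have hs2 := hs.trans (hr w)
      rw [← hs2]
      simp [LinearMap.sum_apply, -Module.Basis.sum_repr]
    rw [key]
    refine Submodule.sum_mem _ fun i _ => Submodule.subset_span ⟨_, _, ⟨j, ?_⟩, rfl⟩
    ext w
    simp only [LinearMap.comp_apply]
    congr 1
    exact Subtype.ext (hmv j j le_rfl w).1

end PaleyWiener
end
end

section
/- π(A) = End(π)^#: the set {π(a) : a ∈ A} of operators on V coincides with the set of φ ∈ End(V)₀ such that for every integer m ≥ 1 and every A-submodule W of V^m (a k-subspace of Fin m → V invariant under the componentwise action of every π(a)), the componentwise map φ^{×m} : (v_1,…,v_m) ↦ (φ v_1,…,φ v_m) maps W into W. -/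
noncomputable section

namespace PaleyWiener

/-- **double commutant theorem.** Let `A` be a (not necessarily unital)
associative `k`-algebra with an approximate identity `(α_j)_{j ∈ J}` indexed by a directed
preordered set `J`, and let `π : A → End_k(V)` make `V` an approximately unital admissible
`A`-module.  Then `π(A) = End(π)^#`: the set of operators `π(a)`, `a ∈ A`, coincides with
the set of `φ ∈ End(V)₀` such that for every `m ≥ 1`, every `A`-submodule `W` of `V^m`
(i.e. every `k`-subspace of `Fin m → V` invariant under the componentwise action of
every `π(a)`) is invariant under the componentwise map `φ^{×m}`. -/
theorem range_eq_endSharp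
    {k : Type*} [Field k] {A : Type*} [NonUnitalRing A] [Module k A]
    [SMulCommClass k A A] [IsScalarTower k A A]
    {V : Type*} [AddCommGroup V] [Module k V]
    (π : A →ₙₐ[k] Module.End k V)
    {J : Type*} [Preorder J] (hdir : ∀ j₁ j₂ : J, ∃ j, j₁ ≤ j ∧ j₂ ≤ j)
    (α : J → A)
    (happrox : ∀ j₁ j₂, j₁ ≤ j₂ → α j₁ * α j₂ = α j₁ ∧ α j₂ * α j₁ = α j₁)
    (habsorb : ∀ a : A, ∃ j, α j * a = a ∧ a * α j = a)
    (hau : ∀ v : V, ∃ j, π (α j) v = v)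
    (hadm : ∀ j, FiniteDimensional k (LinearMap.range (π (α j)))) :
    {φ : Module.End k V | ∃ a : A, φ = π a} =
      {φ : Module.End k V |
        φ ∈ Submodule.span k {ψ : Module.End k V |
          ∃ (v : V) (ξ : Module.Dual k V), (∃ j, ξ ∘ₗ π (α j) = ξ) ∧
            ψ = LinearMap.smulRight ξ v} ∧
        ∀ (m : ℕ), 1 ≤ m → ∀ W : Submodule k (Fin m → V),
          (∀ (a : A), ∀ w ∈ W, (fun i => π a (w i)) ∈ W) →
          ∀ w ∈ W, (fun i => φ (w i)) ∈ W} := by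
  ext φ
  simp only [Set.mem_ofPred_eq]
  constructor
  · rintro ⟨a, rfl⟩
    refine ⟨?_, fun m _ W hW w hw => hW a w hw⟩
    obtain ⟨j, h1, h2⟩ := habsorb a
    have := hadm j
    let b := Module.finBasis k (LinearMap.range (π (α j)))
    let c : Fin _ → Module.Dual k V := fun i =>
      (b.coord i) ∘ₗ (π (α j)).rangeRestrict ∘ₗ π a
    have key : π a = ∑ i, LinearMap.smulRight (c i) ((b i : V)) := by
      ext v
      have h := congrArg (Subtype.val) (b.sum_repr ((π (α j)).rangeRestrict (π a v)))
      have h3 : π (α j) (π a v) = π a v := by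
        rw [← Module.End.mul_apply, ← map_mul, h1]
      simp only [Submodule.coe_sum, Submodule.coe_smul] at h
      simp only [LinearMap.sum_apply, LinearMap.smulRight_apply]
      exact h3.symm.trans h.symm
    rw [key]
    refine Submodule.sum_mem _ fun i _ => Submodule.subset_span ⟨_, _, ⟨j, ?_⟩, rfl⟩
    ext v
    have h4 : π a (π (α j) v) = π a v := by
      rw [← Module.End.mul_apply, ← map_mul, h2]
    simp only [c, LinearMap.comp_apply, h4]
  · rintro ⟨hφ, hinv⟩
    have hj : ∃ j, φ * π (α j) = φ := by
      clear hinv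
      induction hφ using Submodule.span_induction with
      | mem x hx =>
        obtain ⟨v, ξ, ⟨j, hj⟩, rfl⟩ := hx
        refine ⟨j, ?_⟩
        ext w
        have := LinearMap.congr_fun hj w
        simp only [LinearMap.comp_apply] at this
        simp [this]
      | zero =>
        obtain ⟨j, _⟩ := habsorb 0
        exact ⟨j, zero_mul _⟩
      | add x y _ _ hx hy =>
        obtain ⟨j₁, h1⟩ := hx
        obtain ⟨j₂, h2⟩ := hy
        obtain ⟨j, l1, l2⟩ := hdir j₁ j₂
        refine ⟨j, ?_⟩
        rw [add_mul]
        congr 1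
        · rw [← h1, mul_assoc, ← map_mul, (happrox _ _ l1).1]
        · rw [← h2, mul_assoc, ← map_mul, (happrox _ _ l2).1]
      | smul c x _ hx =>
        obtain ⟨j, h⟩ := hx
        exact ⟨j, by rw [smul_mul_assoc, h]⟩
    obtain ⟨j, hj⟩ := hj
    have hfg : (LinearMap.range (π (α j))).FG := Module.Finite.iff_fg.mp (hadm j)
    obtain ⟨n, s, hs⟩ := Submodule.fg_iff_exists_fin_generating_family.mp hfg
    let t : Fin (n + 1) → V := Fin.cons 0 s
    let F : A →ₗ[k] (Fin (n + 1) → V) :=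
      { toFun := fun a i => π a (t i)
        map_add' := fun x y => by ext i; simp
        map_smul' := fun x y => by ext i; simp }
    have hidem : ∀ v ∈ LinearMap.range (π (α j)), π (α j) v = v := by
      rintro _ ⟨u, rfl⟩
      rw [← Module.End.mul_apply, ← map_mul, (happrox j j le_rfl).1]
    have ht : t ∈ LinearMap.range F := by
      refine ⟨α j, ?_⟩
      ext i
      refine Fin.cases ?_ (fun i => ?_) i
      · simp [F, t]
      · simp only [F, t, LinearMap.coe_mk, AddHom.coe_mk, Fin.cons_succ]
        exact hidem _ (hs ▸ Submodule.subset_span ⟨i, rfl⟩)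
    obtain ⟨a, ha⟩ := hinv (n + 1) (by omega) (LinearMap.range F) (by
      rintro a _ ⟨b, rfl⟩
      refine ⟨a * b, ?_⟩
      ext i
      simp [F]) t ht
    refine ⟨a * α j, ?_⟩
    have heq : Set.EqOn φ (π a) (Submodule.span k (Set.range s)) := by
      apply LinearMap.eqOn_span
      rintro _ ⟨i, rfl⟩
      have := congrFun ha i.succ
      simpa [F, t] using this.symm
    rw [hs] at heq
    rw [map_mul, ← hj]
    ext v
    exact heq ⟨v, rfl⟩

end PaleyWiener
end
end

section
/- Let R be a ring, V₁ and V₂ R-modules, and φ₁ : V₁ →+ V₁, φ₂ : V₂ →+ V₂ additive endomorphisms such that every R-submodule W of V₁ × V₂ is invariant under the map (x, y) ↦ (φ₁ x, φ₂ y). Let U₁ ⊆ W₁ be R-submodules of V₁ and U₂ ⊆ W₂ be R-submodules of V₂. Then φ_i(W_i) ⊆ W_i and φ_i(U_i) ⊆ U_i for i = 1, 2, so φ_i induces an additive endomorphism φ̄_i of the quotient module W_i/U_i; and for every R-linear map T : W₁/U₁ → W₂/U₂ one has T ∘ φ̄₁ = φ̄₂ ∘ T. (This is the abstract content of the paper's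 lemma that invariance of all invariant subspaces implies the intertwining conditions for subquotients.) -/
noncomputable section

namespace PaleyWiener

/-- Let `R` be a ring, `V₁, V₂` be `R`-modules and `φ₁, φ₂` additive
endomorphisms such that every `R`-submodule `W` of `V₁ × V₂` is invariant under
`(x, y) ↦ (φ₁ x, φ₂ y)`.  Let `U₁ ⊆ W₁` and `U₂ ⊆ W₂` be `R`-submodules of `V₁` resp. `V₂`.
Then `φᵢ(Wᵢ) ⊆ Wᵢ` and `φᵢ(Uᵢ) ⊆ Uᵢ`, so `φᵢ` induces an additive endomorphism `φ̄ᵢ` of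
`Wᵢ/Uᵢ`; and every `R`-linear `T : W₁/U₁ → W₂/U₂` intertwines `φ̄₁` with `φ̄₂`
(`T ∘ φ̄₁ = φ̄₂ ∘ T`, expressed pointwise: if `T⟦x⟧ = ⟦y⟧` then `T⟦φ₁ x⟧ = ⟦φ₂ y⟧`). -/
theorem intertwining_of_invariant_subspaces
    {R V₁ V₂ : Type*} [Ring R] [AddCommGroup V₁] [Module R V₁]
    [AddCommGroup V₂] [Module R V₂] (φ₁ : V₁ →+ V₁) (φ₂ : V₂ →+ V₂)
    (hinv : ∀ W : Submodule R (V₁ × V₂), ∀ x ∈ W, (φ₁ x.1, φ₂ x.2) ∈ W)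
    (U₁ W₁ : Submodule R V₁) (hUW₁ : U₁ ≤ W₁)
    (U₂ W₂ : Submodule R V₂) (hUW₂ : U₂ ≤ W₂) :
    (∀ x ∈ W₁, φ₁ x ∈ W₁) ∧ (∀ x ∈ U₁, φ₁ x ∈ U₁) ∧
    (∀ x ∈ W₂, φ₂ x ∈ W₂) ∧ (∀ x ∈ U₂, φ₂ x ∈ U₂) ∧
    (∀ (hW₁ : ∀ x ∈ W₁, φ₁ x ∈ W₁) (hW₂ : ∀ x ∈ W₂, φ₂ x ∈ W₂)
      (T : (W₁ ⧸ (U₁.comap W₁.subtype)) →ₗ[R] (W₂ ⧸ (U₂.comap W₂.subtype)))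
      (x : W₁) (y : W₂),
      T (Submodule.Quotient.mk x) = Submodule.Quotient.mk y →
      T (Submodule.Quotient.mk ⟨φ₁ x, hW₁ x x.2⟩) =
        Submodule.Quotient.mk ⟨φ₂ y, hW₂ y y.2⟩) := by
  have h1 : ∀ W : Submodule R V₁, ∀ x ∈ W, φ₁ x ∈ W := fun W x hx =>
    hinv (W.comap (LinearMap.fst R V₁ V₂)) (x, 0) hx
  have h2 : ∀ W : Submodule R V₂, ∀ x ∈ W, φ₂ x ∈ W := fun W x hx =>
    hinv (W.comap (LinearMap.snd R V₁ V₂)) (0, x) hx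
  refine ⟨h1 W₁, h1 U₁, h2 W₂, h2 U₂, ?_⟩
  intro hW₁ hW₂ T x y hxy
  -- the graph of `T`, pulled back to `W₁ × W₂` and pushed into `V₁ × V₂`
  let G : Submodule R (W₁ × W₂) := LinearMap.eqLocus
    ((T ∘ₗ Submodule.mkQ _) ∘ₗ LinearMap.fst R W₁ W₂)
    ((Submodule.mkQ (U₂.comap W₂.subtype)) ∘ₗ LinearMap.snd R W₁ W₂)
  have hG : (x, y) ∈ G := hxy
  have key := hinv (G.map (W₁.subtype.prodMap W₂.subtype)) ((x : V₁), (y : V₂))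
    ⟨(x, y), hG, rfl⟩
  obtain ⟨⟨a, b⟩, hab, he⟩ := key
  have ha : (a : V₁) = φ₁ x := congrArg Prod.fst he
  have hb : (b : V₂) = φ₂ y := congrArg Prod.snd he
  have ha' : a = ⟨φ₁ x, hW₁ x x.2⟩ := Subtype.ext ha
  have hb' : b = ⟨φ₂ y, hW₂ y y.2⟩ := Subtype.ext hb
  rw [← ha', ← hb']
  exact hab

end PaleyWiener
end
end

section
/- Let R be a ring, V an R-module, and φ : V →+ V an additive endomorphism such that for every integer m ≥ 1 and every R-submodule W of V^m (= Fin m → V with the componentwise module structure), the componentwise map φ^{×m} maps W into W. Let U ⊆ W be R-submodules of V. Then φ(W) ⊆ W and φ(U) ⊆ U, and the induced additive endomorphism φ̄ of the quotient R-module W/U again has the property that for every m ≥ 1 and every R-submodule Z of (W/U)^m, the componentwise map φ̄^{×m} maps Z into Z. (This is the abstract content of the paper's lemma that the property of preserving all invariant subspaces of all finite Cartesian powers passes to subquotients.) -/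
noncomputable section

namespace PaleyWiener

/-- The endomorphism of the quotient module `W/U` induced by an additive endomorphism `φ`
of the ambient module which leaves both `W` and `U` invariant. -/
def inducedQuotEndo {R V : Type*} [Ring R] [AddCommGroup V] [Module R V] (φ : V →+ V)
    (W U : Submodule R V) (hW : ∀ x ∈ W, φ x ∈ W) (hU : ∀ x ∈ U, φ x ∈ U) :
    (W ⧸ (U.comap W.subtype)) → (W ⧸ (U.comap W.subtype)) :=
  Quotient.map' (fun x : W => (⟨φ x, hW x x.2⟩ : W)) (by
    intro a b hab
    rw [Submodule.quotientRel_def] at hab ⊢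
    have : φ ((a : V) - b) ∈ U := hU _ hab
    simpa [map_sub] using this)

/-- Let `φ` be an additive endomorphism of an `R`-module `V` such that for
every `m ≥ 1`, every `R`-submodule of `V^m` is invariant under the componentwise map
`φ^{×m}`.  Let `U ⊆ W` be `R`-submodules of `V`.  Then `φ(W) ⊆ W` and `φ(U) ⊆ U`, and the
induced additive endomorphism `φ̄` of `W/U` has the same property: for every `m ≥ 1`,
every `R`-submodule of `(W/U)^m` is invariant under `φ̄^{×m}`. -/
theorem invariance_passes_to_subquotients
    {R V : Type*} [Ring R] [AddCommGroup V] [Module R V] (φ : V →+ V)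
    (hinv : ∀ (m : ℕ), 1 ≤ m → ∀ W : Submodule R (Fin m → V),
      ∀ w ∈ W, (fun i => φ (w i)) ∈ W)
    (U W : Submodule R V) (hUW : U ≤ W) :
    ∃ (hW : ∀ x ∈ W, φ x ∈ W) (hU : ∀ x ∈ U, φ x ∈ U),
      ∀ (m : ℕ), 1 ≤ m → ∀ Z : Submodule R (Fin m → (W ⧸ (U.comap W.subtype))),
        ∀ z ∈ Z, (fun i => inducedQuotEndo φ W U hW hU (z i)) ∈ Z := by
  have key : ∀ S : Submodule R V, ∀ x ∈ S, φ x ∈ S := fun S x hx =>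
    hinv 1 le_rfl (S.comap (LinearMap.proj (0 : Fin 1))) (fun _ => x) hx
  refine ⟨key W, key U, ?_⟩
  intro m hm Z z hz
  choose w hw using fun i => Submodule.mkQ_surjective (U.comap W.subtype) (z i)
  obtain rfl : (fun i => (U.comap W.subtype).mkQ (w i)) = z := funext hw
  have h := hinv m hm
    ((Z.comap (LinearMap.compLeft (U.comap W.subtype).mkQ (Fin m))).map
      (LinearMap.compLeft W.subtype (Fin m)))
    (fun i => (w i : V)) ⟨w, hz, rfl⟩
  obtain ⟨w', hw', he⟩ := h
  have hw2 : w' = fun i => (⟨φ (w i), key W _ (w i).2⟩ : W) := by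
    funext i
    exact Subtype.ext (congrFun he i)
  subst hw2
  exact hw'

end PaleyWiener
end
end
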